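/- arXiv:1911.11724 — 3 statements merged into one kernel-verified Lean document; each statement's English description precedes it below -/
import Mathlib

section
/- Fix τ in the upper half-plane ℍ. Suppose f : ℂ⁸ → ℂ is holomorphic and satisfies, for every root α of the E₈ lattice Λ_{E₈}, every m ∈ ℂ⁸ and all ε₁, ε₂ ∈ ℂ, the functional equation θ₁(τ, ε₂)·θ₁(τ, α·m + ε₂)·f(m + ε₁α) − θ₁(τ, ε₁)·θ₁(τ, α·m + ε₁)·f(m + ε₂α) = θ₁(τ, ε₂ − ε₁)·θ₁(τ, α·m + ε₁ + ε₂)·f(m). Then there exists a constant c ∈ ℂ such that f(m) = c·Θ_{E₈}(τ, m) for all m ∈ ℂ⁸. -/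
/-- The Jacobi theta function θ₁(τ,z). -/
noncomputable def theta1 (τ z : ℂ) : ℂ :=
  -Complex.I * ∑' n : ℤ, (-1 : ℂ) ^ n *
    Complex.exp (Real.pi * Complex.I * τ * ((n : ℂ) + 1 / 2) ^ 2 +
      2 * Real.pi * Complex.I * ((n : ℂ) + 1 / 2) * z)

/-- The E₈ lattice: vectors of ℝ⁸ whose coordinates are all integers
or all half-integers, with even coordinate sum. -/
def E8Lattice : Set (Fin 8 → ℝ) :=
  {x | ((∀ i, ∃ k : ℤ, x i = k) ∨ (∀ i, ∃ k : ℤ, x i = k + 1 / 2)) ∧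
    ∃ k : ℤ, ∑ i, x i = 2 * k}

/-- The standard dot product on ℝ⁸. -/
def dotR (x y : Fin 8 → ℝ) : ℝ := ∑ i, x i * y i

/-- The pairing m·w for m ∈ ℂ⁸ and w ∈ ℝ⁸. -/
noncomputable def dotC (m : Fin 8 → ℂ) (w : Fin 8 → ℝ) : ℂ := ∑ i, m i * (w i : ℂ)

/-- The E₈ theta function Θ_{E₈}(τ,m). -/
noncomputable def ThetaE8 (τ : ℂ) (m : Fin 8 → ℂ) : ℂ :=
  ∑' w : E8Lattice, Complex.exp (Real.pi * Complex.I * τ *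
    (dotR (w : Fin 8 → ℝ) (w : Fin 8 → ℝ) : ℂ) +
    2 * Real.pi * Complex.I * dotC m (w : Fin 8 → ℝ))

section Theta

open Complex

theorem theta1_eq_jacobiTheta₂ (τ z : ℂ) :
    theta1 τ z = -I * exp (Real.pi * I * τ / 4 + Real.pi * I * z) *
      jacobiTheta₂ (z + τ / 2 + 1 / 2) τ := by
  rw [theta1, jacobiTheta₂, mul_assoc (-I), ← tsum_mul_left (a := exp _)]
  refine congrArg (-I * ·) (tsum_congr fun n => ?_)
  have h : (-1 : ℂ) ^ n = exp (n * (Real.pi * I)) := by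
    rw [exp_int_mul, exp_pi_mul_I]
  rw [jacobiTheta₂_term, h, ← exp_add, ← exp_add]
  congr 1
  ring

theorem differentiable_theta1 {τ : ℂ} (hτ : 0 < τ.im) : Differentiable ℂ (theta1 τ) := by
  have h : theta1 τ = fun z => -I * exp (Real.pi * I * τ / 4 + Real.pi * I * z) *
      jacobiTheta₂ (z + τ / 2 + 1 / 2) τ := funext (theta1_eq_jacobiTheta₂ τ)
  rw [h]
  intro z
  have h₂ : DifferentiableAt ℂ (fun z => jacobiTheta₂ (z + τ / 2 + 1 / 2) τ) z :=
    (differentiableAt_jacobiTheta₂_fst (z + τ / 2 + 1 / 2) hτ).comp z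
      (f := fun z => z + τ / 2 + 1 / 2) (by fun_prop)
  fun_prop

theorem theta1_add_one (τ z : ℂ) : theta1 τ (z + 1) = -theta1 τ z := by
  rw [theta1_eq_jacobiTheta₂, theta1_eq_jacobiTheta₂,
    show z + 1 + τ / 2 + 1 / 2 = z + τ / 2 + 1 / 2 + 1 by ring, jacobiTheta₂_add_left,
    show Real.pi * I * τ / 4 + Real.pi * I * (z + 1) =
      (Real.pi * I * τ / 4 + Real.pi * I * z) + Real.pi * I by ring, exp_add _ (Real.pi * I),
    exp_pi_mul_I]
  ring

theorem theta1_add_tau (τ z : ℂ) :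
    theta1 τ (z + τ) = -exp (-Real.pi * I * τ - 2 * Real.pi * I * z) * theta1 τ z := by
  rw [theta1_eq_jacobiTheta₂, theta1_eq_jacobiTheta₂,
    show z + τ + τ / 2 + 1 / 2 = z + τ / 2 + 1 / 2 + τ by ring, jacobiTheta₂_add_left']
  have h : exp (Real.pi * I * τ / 4 + Real.pi * I * (z + τ)) *
      exp (-Real.pi * I * (τ + 2 * (z + τ / 2 + 1 / 2))) =
      -exp (-Real.pi * I * τ - 2 * Real.pi * I * z) *
        exp (Real.pi * I * τ / 4 + Real.pi * I * z) := by
    rw [← exp_add, neg_mul (exp _), ← exp_add, ← neg_one_mul (exp _), ← exp_pi_mul_I, ← exp_add,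
      Complex.exp_eq_exp_iff_exists_int]
    exact ⟨-1, by push_cast; ring⟩
  linear_combination (-I * jacobiTheta₂ (z + τ / 2 + 1 / 2) τ) * h

theorem theta1_sub_one (τ z : ℂ) : theta1 τ (z - 1) = -theta1 τ z := by
  have h := theta1_add_one τ (z - 1)
  rw [sub_add_cancel] at h
  rw [h, neg_neg]

theorem theta1_sub_tau (τ z : ℂ) :
    theta1 τ (z - τ) = -exp (-Real.pi * I * τ + 2 * Real.pi * I * z) * theta1 τ z := by
  have h := theta1_add_tau τ (z - τ)
  rw [sub_add_cancel] at h
  rw [h, ← mul_assoc, neg_mul_neg, ← exp_add,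
    show -Real.pi * I * τ + 2 * Real.pi * I * z +
      (-Real.pi * I * τ - 2 * Real.pi * I * (z - τ)) = 0 by ring, exp_zero, one_mul]

theorem theta1_zero (τ : ℂ) : theta1 τ 0 = 0 := by
  have h₁ : jacobiTheta₂ (0 + τ / 2 + 1 / 2) τ = -jacobiTheta₂ (0 + τ / 2 + 1 / 2) τ := by
    have h₂ := jacobiTheta₂_add_left' (-(τ / 2 + 1 / 2)) τ
    rw [jacobiTheta₂_neg_left, show -(τ / 2 + 1 / 2) + τ = -1 + (τ / 2 + 1 / 2) by ring,
      show -Real.pi * I * (τ + 2 * -(τ / 2 + 1 / 2)) = Real.pi * I by ring, exp_pi_mul_I,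
      ← jacobiTheta₂_add_left, neg_add_cancel_comm] at h₂
    rw [zero_add]
    linear_combination h₂
  rw [theta1_eq_jacobiTheta₂, self_eq_neg.mp h₁, mul_zero]

theorem exists_jacobiTheta₂_ne_zero {τ : ℂ} (hτ : 0 < τ.im) : ∃ z, jacobiTheta₂ z τ ≠ 0 := by
  by_contra! H
  let g : ℤ → C(ℝ, ℂ) := fun n =>
    ⟨fun x => jacobiTheta₂_term n x τ, by unfold jacobiTheta₂_term; fun_prop⟩
  have hsum : Summable fun n : ℤ =>
      ‖(g n).restrict (⟨Set.uIcc 0 1, isCompact_uIcc⟩ : TopologicalSpace.Compacts ℝ)‖ := by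
    refine Summable.of_nonneg_of_le (fun _ => norm_nonneg _) (fun n => ?_)
      ((summable_jacobiTheta₂_term_iff 0 τ).mpr hτ).norm
    refine (ContinuousMap.norm_le _ (norm_nonneg _)).mpr fun x => ?_
    simp [g, norm_jacobiTheta₂_term]
  have h := intervalIntegral.hasSum_intervalIntegral_of_summable_norm hsum
  have h₀ : ∀ x : ℝ, ∑' n, g n x = 0 := fun x => H x
  simp only [h₀, intervalIntegral.integral_zero] at h
  have hint : ∀ n : ℤ, n ≠ 0 → ∫ x in (0 : ℝ)..1, g n x = 0 := by
    intro n hn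
    have hn' : (2 * Real.pi * I * n : ℂ) ≠ 0 := by
      simp [Real.pi_ne_zero, hn]
    have : ∀ x : ℝ, g n x = exp (Real.pi * I * n ^ 2 * τ) * exp (2 * Real.pi * I * n * x) := by
      intro x
      simp [g, jacobiTheta₂_term, ← exp_add, add_comm]
    simp only [this]
    rw [intervalIntegral.integral_const_mul, integral_exp_mul_complex hn',
      show 2 * Real.pi * I * n * ((1 : ℝ) : ℂ) = n * (2 * Real.pi * I) by push_cast; ring,
      exp_int_mul_two_pi_mul_I]
    simp
  have h₁ := (hasSum_single 0 hint).unique h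
  simp [g, jacobiTheta₂_term] at h₁

theorem exists_theta1_mul_theta1_ne_zero {τ : ℂ} (hτ : 0 < τ.im) (x : ℂ) :
    ∃ ε, theta1 τ ε * theta1 τ (x + ε) ≠ 0 := by
  obtain ⟨z, hz⟩ := exists_jacobiTheta₂_ne_zero hτ
  have hne : theta1 τ (z - τ / 2 - 1 / 2) ≠ 0 := by
    rw [theta1_eq_jacobiTheta₂]
    refine mul_ne_zero (mul_ne_zero (by simp) (exp_ne_zero _)) ?_
    convert hz using 2
    ring
  by_contra! H
  have hd := differentiable_theta1 hτ
  have hd' : Differentiable ℂ fun ε => theta1 τ (x + ε) := hd.comp (by fun_prop)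
  rcases AnalyticOnNhd.eq_zero_or_eq_zero_of_mul_eq_zero
    (hd.differentiableOn.analyticOnNhd isOpen_univ)
    (hd'.differentiableOn.analyticOnNhd isOpen_univ) (fun ε _ => H ε)
    isPreconnected_univ with h | h
  · exact hne (h _ trivial)
  · apply hne
    have := h (z - τ / 2 - 1 / 2 - x) trivial
    simpa using this

end Theta

section Fourier

open MeasureTheory UnitAddTorus

theorem differentiable_integral_of_continuous {X : Type*} [TopologicalSpace X] [CompactSpace X]
    [MeasurableSpace X] [BorelSpace X] [SecondCountableTopology X] (μ : Measure X)
    [IsFiniteMeasure μ] {Ψ : ℂ → X → ℂ} (hc : Continuous Ψ.uncurry)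
    (hd : ∀ t, Differentiable ℂ fun s => Ψ s t) :
    Differentiable ℂ fun s => ∫ t, Ψ s t ∂μ := by
  intro s₀
  obtain ⟨C, hC⟩ := ((isCompact_closedBall s₀ 2).prod
    (isCompact_univ (X := X))).exists_bound_of_continuousOn hc.continuousOn
  have hcs : ∀ s, Continuous (Ψ s) := fun s => hc.comp (Continuous.prodMk_right s)
  have hint : ∀ s, Integrable (Ψ s) μ := fun s =>
    (hcs s).integrable_of_hasCompactSupport (HasCompactSupport.of_compactSpace _)
  have hswap : Continuous (Function.uncurry fun t s => Ψ s t) := hc.comp continuous_swap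
  refine ((hasDerivAt_integral_of_dominated_loc_of_deriv_le (μ := μ) (F := Ψ)
    (F' := fun s t => deriv (fun s => Ψ s t) s) (bound := fun _ => C)
    (Metric.ball_mem_nhds s₀ one_pos) (Filter.Eventually.of_forall fun s =>
      (hcs s).aestronglyMeasurable) (hint s₀) ?_ ?_ (integrable_const _) ?_).2).differentiableAt
  · exact ((measurable_deriv_with_param hswap).comp
      (measurable_id.prodMk measurable_const)).aestronglyMeasurable
  · refine Filter.Eventually.of_forall fun t s hs => ?_
    have := Complex.norm_deriv_le_of_forall_mem_sphere_norm_le (c := s) (R := 1) (C := C)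
      one_pos (hd t).diffContOnCl fun z hz => hC (z, t) ⟨?_, trivial⟩
    · simpa using this
    · rw [Metric.mem_closedBall]
      have h₁ := Metric.mem_sphere.mp hz
      have h₂ := Metric.mem_ball.mp hs
      linarith [dist_triangle z s s₀]
  · exact Filter.Eventually.of_forall fun t s _ => (hd t s).hasDerivAt

/-- An entire function invariant under real translations is constant. -/
theorem eq_of_differentiable_of_add_real {H : ℂ → ℂ} (hH : Differentiable ℂ H)
    (hr : ∀ (s : ℂ) (r : ℝ), H (s + r) = H s) (s s' : ℂ) : H s = H s' := by
  refine is_const_of_deriv_eq_zero hH (fun z => ?_) s s'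
  have h₁ : HasDerivAt (fun w => H (z + w)) (deriv H z) ((0 : ℝ) : ℂ) := by
    have := (hH (z + ((0 : ℝ) : ℂ))).hasDerivAt.comp_const_add z ((0 : ℝ) : ℂ)
    simpa using this
  have h₂ := h₁.comp_ofReal
  simp only [hr] at h₂
  exact h₂.unique (hasDerivAt_const _ _)

variable {d : Type*}

/-- The projection from `ℝᵈ` to the torus. -/
def torusMk (x : d → ℝ) : UnitAddTorus d := fun i => (x i : UnitAddCircle)

theorem isOpenQuotientMap_torusMk : IsOpenQuotientMap (torusMk : (d → ℝ) → UnitAddTorus d) :=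
  IsOpenQuotientMap.piMap fun _ => QuotientAddGroup.isOpenQuotientMap_mk

variable [Fintype d]

theorem mFourier_torusMk (n : d → ℤ) (x : d → ℝ) :
    mFourier n (torusMk x) = Complex.exp (2 * Real.pi * Complex.I * ∑ i, n i * (x i : ℂ)) := by
  simp only [mFourier, torusMk, ContinuousMap.coe_mk, fourier_coe_apply, Finset.mul_sum,
    Complex.exp_sum]
  refine Finset.prod_congr rfl fun i _ => ?_
  congr 1
  push_cast
  ring

/-- The function on `ℂᵈ × (ℝ/ℤ)ᵈ` induced by `(z, x) ↦ F (z + x)` for a `ℤᵈ`-periodic `F`. -/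
noncomputable def torusLift (F : (d → ℂ) → ℂ) (z : d → ℂ) (t : UnitAddTorus d) : ℂ :=
  F (z + fun i => ((isOpenQuotientMap_torusMk.surjective t).choose i : ℂ))

/-- `F` has period `1` in each variable. -/
def IsUnitPeriodic [DecidableEq d] (F : (d → ℂ) → ℂ) : Prop := ∀ z j, F (z + Pi.single j 1) = F z

theorem mFourierCoeff_eq_integral_pi (g : UnitAddTorus d → ℂ) (n : d → ℤ) :
    mFourierCoeff g n = ∫ t, mFourier (-n) t * g t
      ∂(Measure.pi fun _ : d => (AddCircle.haarAddCircle : Measure UnitAddCircle)) := rfl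

variable [DecidableEq d] {F : (d → ℂ) → ℂ}

theorem IsUnitPeriodic.add_int (hF : IsUnitPeriodic F) (z : d → ℂ) (n : d → ℤ) :
    F (z + fun i => (n i : ℂ)) = F z := by
  let S : AddSubgroup (d → ℤ) :=
    { carrier := {n | ∀ z, F (z + fun i => (n i : ℂ)) = F z}
      zero_mem' := fun z => by
        congr 1; ext i; simp
      add_mem' := fun {a b} ha hb z => by
        rw [← ha z, ← hb (z + fun i => (a i : ℂ))]
        congr 1; ext i; simp [add_assoc]
      neg_mem' := fun {a} ha z => by
        rw [← ha (z + _)]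
        congr 1; ext i; simp }
  have hS : ∀ j, Pi.single j (1 : ℤ) ∈ S := fun j z => by
    rw [← hF z j]
    congr 1; ext i
    by_cases h : i = j
    · subst h; simp
    · simp [h]
  have hn : n ∈ S := by
    rw [pi_eq_sum_univ' n]
    exact sum_mem fun j _ => S.zsmul_mem (hS j) _
  exact hn z

theorem torusLift_mk (hF : IsUnitPeriodic F) (z : d → ℂ) (x : d → ℝ) :
    torusLift F z (torusMk x) = F (z + fun i => (x i : ℂ)) := by
  set y := (isOpenQuotientMap_torusMk.surjective (torusMk x)).choose with hy
  have hyx : torusMk y = torusMk x :=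
    (isOpenQuotientMap_torusMk.surjective (torusMk x)).choose_spec
  have h : ∀ i, ∃ k : ℤ, y i = x i + k := fun i => by
    have h₁ : ((y i : ℝ) : UnitAddCircle) = (x i : ℝ) := congrFun hyx i
    rw [QuotientAddGroup.eq, AddSubgroup.mem_zmultiples_iff] at h₁
    obtain ⟨k, hk⟩ := h₁
    refine ⟨-k, ?_⟩
    simp at hk ⊢
    linarith
  choose k hk using h
  rw [torusLift, ← hy, ← hF.add_int (z + fun i => (x i : ℂ)) k]
  congr 1
  ext i
  simp [hk, add_assoc]

theorem continuous_torusLift (hF : IsUnitPeriodic F) (hc : Continuous F) :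
    Continuous (Function.uncurry (torusLift F)) := by
  rw [← ((IsOpenQuotientMap.id (X := d → ℂ)).prodMap
    (isOpenQuotientMap_torusMk (d := d))).continuous_comp_iff]
  have : Function.uncurry (torusLift F) ∘ Prod.map id torusMk =
      fun p : (d → ℂ) × (d → ℝ) => F (p.1 + fun i => (p.2 i : ℂ)) := by
    ext p
    exact torusLift_mk hF _ _
  rw [this]
  fun_prop

/-- The `n`-th Fourier coefficient of `x ↦ F (z + x)`, normalised to be independent of `z`. -/
noncomputable def entireCoeff (F : (d → ℂ) → ℂ) (n : d → ℤ) (z : d → ℂ) : ℂ :=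
  Complex.exp (-(2 * Real.pi * Complex.I * ∑ i, n i * z i)) * mFourierCoeff (torusLift F z) n

theorem mFourierCoeff_torusLift_add_real (hF : IsUnitPeriodic F) (n : d → ℤ) (z : d → ℂ)
    (r : d → ℝ) : mFourierCoeff (torusLift F (z + fun i => (r i : ℂ))) n =
      Complex.exp (2 * Real.pi * Complex.I * ∑ i, n i * (r i : ℂ)) *
        mFourierCoeff (torusLift F z) n := by
  rw [mFourierCoeff_eq_integral_pi, mFourierCoeff_eq_integral_pi, ← integral_const_mul,
    ← integral_add_right_eq_self (fun t => _ * (mFourier (-n) t * torusLift F z t)) (torusMk r)]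
  congr 1
  ext t
  obtain ⟨x, rfl⟩ := isOpenQuotientMap_torusMk.surjective t
  have h : torusMk x + torusMk r = torusMk (x + r) := rfl
  have hz : z + (fun i => (r i : ℂ)) + (fun i => (x i : ℂ)) =
      z + fun i => (((x + r) i : ℝ) : ℂ) := by
    ext i
    simp only [Pi.add_apply]
    push_cast
    ring
  rw [h, torusLift_mk hF, torusLift_mk hF, mFourier_torusMk, mFourier_torusMk, ← mul_assoc,
    ← Complex.exp_add, hz]
  congr 2
  simp only [Pi.add_apply, Pi.neg_apply, Complex.ofReal_add, mul_add, Finset.sum_add_distrib,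
    Int.cast_neg, neg_mul, Finset.sum_neg_distrib]
  ring

theorem entireCoeff_add_real (hF : IsUnitPeriodic F) (n : d → ℤ) (z : d → ℂ) (r : d → ℝ) :
    entireCoeff F n (z + fun i => (r i : ℂ)) = entireCoeff F n z := by
  rw [entireCoeff, entireCoeff, mFourierCoeff_torusLift_add_real hF, ← mul_assoc, ← Complex.exp_add]
  congr 2
  simp only [Pi.add_apply, mul_add, Finset.sum_add_distrib]
  ring

theorem entireCoeff_add_smul_real (hF : IsUnitPeriodic F) (hd : Differentiable ℂ F) (n : d → ℤ)
    (z : d → ℂ) (s : ℂ) (v : d → ℝ) :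
    entireCoeff F n (z + s • fun i => (v i : ℂ)) = entireCoeff F n z := by
  have hH : Differentiable ℂ fun s : ℂ => entireCoeff F n (z + s • fun i => (v i : ℂ)) := by
    simp only [entireCoeff, mFourierCoeff_eq_integral_pi]
    refine Differentiable.mul ?_ (differentiable_integral_of_continuous _ ?_ fun t => ?_)
    · simp only [Pi.add_apply, Pi.smul_apply]
      fun_prop
    · have h := continuous_torusLift hF hd.continuous
      have : Continuous fun p : ℂ × UnitAddTorus d =>
          torusLift F (z + p.1 • fun i => (v i : ℂ)) p.2 :=
        h.comp (f := fun p : ℂ × UnitAddTorus d => (z + p.1 • fun i => (v i : ℂ), p.2))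
          (by fun_prop)
      exact ((mFourier (-n)).continuous.comp continuous_snd).mul this
    · unfold torusLift
      fun_prop
  have := eq_of_differentiable_of_add_real hH (fun s r => ?_) s 0
  · simpa using this
  · rw [← entireCoeff_add_real hF n (z + s • fun i => (v i : ℂ)) (r • v)]
    congr 1
    ext i
    simp [add_mul, add_assoc]

theorem entireCoeff_eq (hF : IsUnitPeriodic F) (hd : Differentiable ℂ F) (n : d → ℤ)
    (z : d → ℂ) : entireCoeff F n z = entireCoeff F n 0 := by
  rw [← entireCoeff_add_smul_real hF hd n 0 Complex.I fun i => (z i).im,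
    ← entireCoeff_add_real hF n (0 + _) fun i => (z i).re]
  congr 1
  ext i
  simp [mul_comm Complex.I, add_comm _ (((z i).re : ℝ) : ℂ), Complex.re_add_im]

/-- The Fourier expansion of an entire periodic function. -/
theorem hasSum_entireCoeff (hF : IsUnitPeriodic F) (hd : Differentiable ℂ F) (z : d → ℂ)
    (hs : Summable fun n : d → ℤ =>
      entireCoeff F n 0 * Complex.exp (2 * Real.pi * Complex.I * ∑ i, n i * z i)) :
    HasSum (fun n : d → ℤ =>
      entireCoeff F n 0 * Complex.exp (2 * Real.pi * Complex.I * ∑ i, n i * z i)) (F z) := by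
  let g : C(UnitAddTorus d, ℂ) := ⟨torusLift F z,
    (continuous_torusLift hF hd.continuous).comp (Continuous.prodMk_right z)⟩
  have hg : ∀ n : d → ℤ, mFourierCoeff g n =
      entireCoeff F n 0 * Complex.exp (2 * Real.pi * Complex.I * ∑ i, n i * z i) := fun n => by
    rw [← entireCoeff_eq hF hd n z, entireCoeff, mul_right_comm, ← Complex.exp_add,
      neg_add_cancel, Complex.exp_zero, one_mul]
    rfl
  have h := hasSum_mFourier_series_apply_of_summable (f := g)
    (by simpa only [← hg] using hs) (torusMk 0)
  have hz : g (torusMk 0) = F z := by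
    refine (torusLift_mk hF z 0).trans ?_
    congr 1
    ext i
    simp
  rw [hz] at h
  simpa [hg, mFourier_torusMk] using h

/-- The recursion on Fourier coefficients coming from quasi-periodicity. -/
theorem entireCoeff_add_of_quasiperiodic (hF : IsUnitPeriodic F) (hd : Differentiable ℂ F) {τ : ℂ}
    {j : d} {g : d → ℤ}
    (hq : ∀ z, F (z + τ • Pi.single j 1) =
      Complex.exp (-(2 * Real.pi * Complex.I * (τ + ∑ i, (g i : ℂ) * z i))) * F z) (n : d → ℤ) :
    entireCoeff F (n + g) 0 =
      Complex.exp (2 * Real.pi * Complex.I * τ * (n j + 1)) * entireCoeff F n 0 := by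
  have h : mFourierCoeff (torusLift F (τ • Pi.single j 1)) n =
      Complex.exp (-(2 * Real.pi * Complex.I * τ)) * mFourierCoeff (torusLift F 0) (n + g) := by
    rw [mFourierCoeff_eq_integral_pi, mFourierCoeff_eq_integral_pi, ← integral_const_mul]
    congr 1
    ext t
    obtain ⟨x, rfl⟩ := isOpenQuotientMap_torusMk.surjective t
    rw [torusLift_mk hF, torusLift_mk hF, add_comm _ (fun i => (x i : ℂ)), hq, zero_add, neg_add n,
      mFourier_add, mFourier_torusMk (-g), mul_add, neg_add, Complex.exp_add]
    simp only [Pi.neg_apply, Int.cast_neg, neg_mul, Finset.sum_neg_distrib, mul_neg]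
    ring
  rw [← entireCoeff_eq hF hd n (τ • Pi.single j 1), entireCoeff, entireCoeff, h, ← mul_assoc,
    ← mul_assoc, ← Complex.exp_add, ← Complex.exp_add]
  congr 2
  simp [Pi.single_apply]
  ring

end Fourier

section Lattice

/-- Twice the simple roots of `E₈`. -/
def e8TwoRoot : Fin 8 → Fin 8 → ℤ :=
  ![![1, -1, -1, -1, -1, -1, -1, 1], ![2, 2, 0, 0, 0, 0, 0, 0], ![-2, 2, 0, 0, 0, 0, 0, 0],
    ![0, -2, 2, 0, 0, 0, 0, 0], ![0, 0, -2, 2, 0, 0, 0, 0], ![0, 0, 0, -2, 2, 0, 0, 0],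
    ![0, 0, 0, 0, -2, 2, 0, 0], ![0, 0, 0, 0, 0, -2, 2, 0]]

/-- Twice the fundamental weights of `E₈`. -/
def e8TwoWeight : Fin 8 → Fin 8 → ℤ :=
  ![![0, 0, 0, 0, 0, 0, 0, 4], ![1, 1, 1, 1, 1, 1, 1, 5], ![-1, 1, 1, 1, 1, 1, 1, 7],
    ![0, 0, 2, 2, 2, 2, 2, 10], ![0, 0, 0, 2, 2, 2, 2, 8], ![0, 0, 0, 0, 2, 2, 2, 6],
    ![0, 0, 0, 0, 0, 2, 2, 4], ![0, 0, 0, 0, 0, 0, 2, 2]]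

/-- The Cartan matrix of `E₈`. -/
def e8Cartan (j k : Fin 8) : ℤ := (∑ i, e8TwoRoot j i * e8TwoRoot k i) / 4

/-- The inverse of the Cartan matrix of `E₈`. -/
def e8CartanInv (j k : Fin 8) : ℤ := (∑ i, e8TwoWeight j i * e8TwoWeight k i) / 4

theorem sum_e8TwoRoot_mul_e8TwoRoot :
    ∀ j k, ∑ i, e8TwoRoot j i * e8TwoRoot k i = 4 * e8Cartan j k := by decide

theorem e8Cartan_self : ∀ j, e8Cartan j j = 2 := by decide

theorem sum_e8TwoRoot_mul_e8TwoWeight :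
    ∀ j k, ∑ i, e8TwoRoot j i * e8TwoWeight k i = if j = k then 4 else 0 := by decide

theorem sum_e8TwoWeight_mul_e8TwoRoot :
    ∀ i k, ∑ j, e8TwoWeight j k * e8TwoRoot j i = if k = i then 4 else 0 := by decide

theorem sum_e8Cartan_mul_e8TwoWeight :
    ∀ j i, ∑ k, e8Cartan j k * e8TwoWeight k i = e8TwoRoot j i := by decide

theorem sum_e8CartanInv_smul_e8Cartan :
    ∀ i, ∑ k, e8CartanInv i k • e8Cartan k = Pi.single i 1 := by decide

/-- The simple roots of `E₈`. -/
noncomputable def e8Root (j i : Fin 8) : ℝ := e8TwoRoot j i / 2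

theorem half_mem_E8Lattice {y : Fin 8 → ℤ} (h₂ : ∀ i, y i % 2 = y 0 % 2)
    (h₄ : (∑ i, y i) % 4 = 0) : (fun i => (y i : ℝ) / 2) ∈ E8Lattice := by
  refine ⟨?_, (∑ i, y i) / 4, ?_⟩
  · rcases Int.emod_two_eq_zero_or_one (y 0) with h | h
    · refine Or.inl fun i => ⟨y i / 2, ?_⟩
      have : y i = 2 * (y i / 2) := by have := h₂ i; omega
      rify at this
      linarith
    · refine Or.inr fun i => ⟨y i / 2, ?_⟩
      have : y i = 2 * (y i / 2) + 1 := by have := h₂ i; omega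
      rify at this
      linarith
  · have : ∑ i, y i = 4 * ((∑ i, y i) / 4) := by omega
    rify at this
    rw [← Finset.sum_div]
    linarith

theorem exists_half_of_mem_E8Lattice {w : Fin 8 → ℝ} (hw : w ∈ E8Lattice) :
    ∃ y : Fin 8 → ℤ, (∀ i, w i = y i / 2) ∧ (∀ i, y i % 2 = y 0 % 2) ∧ (∑ i, y i) % 4 = 0 := by
  obtain ⟨h, k, hk⟩ := hw
  have key : ∀ y : Fin 8 → ℤ, (∀ i, w i = y i / 2) → (∑ i, y i) % 4 = 0 := fun y hy => by
    simp only [hy, ← Finset.sum_div] at hk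
    have : ∑ i, y i = 4 * k := by
      rify
      linarith
    omega
  rcases h with h | h
  · choose y hy using h
    have hy' : ∀ i, w i = ((2 * y i : ℤ) : ℝ) / 2 := fun i => by rw [hy]; push_cast; ring
    exact ⟨fun i => 2 * y i, hy', fun i => by grind, key _ hy'⟩
  · choose y hy using h
    have hy' : ∀ i, w i = ((2 * y i + 1 : ℤ) : ℝ) / 2 := fun i => by rw [hy]; push_cast; ring
    exact ⟨fun i => 2 * y i + 1, hy', fun i => by grind, key _ hy'⟩

theorem e8Root_mem (j : Fin 8) : e8Root j ∈ E8Lattice :=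
  half_mem_E8Lattice ((by decide : ∀ j i, e8TwoRoot j i % 2 = e8TwoRoot j 0 % 2) j)
    ((by decide : ∀ j, (∑ i, e8TwoRoot j i) % 4 = 0) j)

theorem dotR_e8Root (j k : Fin 8) : dotR (e8Root j) (e8Root k) = e8Cartan j k := by
  have h := sum_e8TwoRoot_mul_e8TwoRoot j k
  rify at h
  have h' : dotR (e8Root j) (e8Root k) = (∑ i, (e8TwoRoot j i : ℝ) * e8TwoRoot k i) / 4 := by
    rw [dotR, Finset.sum_div]
    refine Finset.sum_congr rfl fun i _ => ?_
    rw [e8Root, e8Root]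
    ring
  rw [h', h]
  ring

/-- Twice the lattice vector with given pairings with the simple roots. -/
def e8TwoVec (n : Fin 8 → ℤ) (i : Fin 8) : ℤ := ∑ j, n j * e8TwoWeight j i

/-- The lattice vector with given pairings with the simple roots. -/
noncomputable def e8Vec (n : Fin 8 → ℤ) (i : Fin 8) : ℝ := e8TwoVec n i / 2

theorem e8Vec_mem (n : Fin 8 → ℤ) : e8Vec n ∈ E8Lattice := by
  refine half_mem_E8Lattice (fun i => ?_) ?_
  · refine Int.ModEq.sum fun j _ => Int.ModEq.mul_left _ ?_
    exact (by decide : ∀ j i, e8TwoWeight j i % 2 = e8TwoWeight j 0 % 2) j i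
  · simp only [e8TwoVec]
    rw [Finset.sum_comm, ← Int.dvd_iff_emod_eq_zero]
    refine Finset.dvd_sum fun j _ => ?_
    rw [← Finset.mul_sum]
    exact ((by decide : ∀ j, 4 ∣ ∑ i, e8TwoWeight j i) j).mul_left _

theorem sum_e8TwoRoot_mul_e8TwoVec (n : Fin 8 → ℤ) (j : Fin 8) :
    ∑ i, e8TwoRoot j i * e8TwoVec n i = 4 * n j := by
  simp only [e8TwoVec, Finset.mul_sum]
  rw [Finset.sum_comm]
  have : ∀ k i, e8TwoRoot j i * (n k * e8TwoWeight k i) =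
      n k * (e8TwoRoot j i * e8TwoWeight k i) := fun k i => by ring
  simp only [this, ← Finset.mul_sum, sum_e8TwoRoot_mul_e8TwoWeight]
  simp [mul_comm]

theorem e8TwoVec_injective : Function.Injective e8TwoVec := fun n n' h => by
  ext j
  have h₁ := sum_e8TwoRoot_mul_e8TwoVec n j
  have h₂ := sum_e8TwoRoot_mul_e8TwoVec n' j
  rw [h, h₂] at h₁
  omega

theorem four_dvd_sum_e8TwoRoot_mul {y : Fin 8 → ℤ} (h₂ : ∀ i, y i % 2 = y 0 % 2)
    (h₄ : (∑ i, y i) % 4 = 0) (j : Fin 8) : 4 ∣ ∑ i, e8TwoRoot j i * y i := by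
  have h1 := h₂ 1
  have h2 := h₂ 2
  have h3 := h₂ 3
  have h4 := h₂ 4
  have h5 := h₂ 5
  have h6 := h₂ 6
  have h7 := h₂ 7
  rw [Fin.sum_univ_eight] at h₄ ⊢
  fin_cases j <;> simp [e8TwoRoot] <;> omega

theorem exists_e8Vec_eq {w : Fin 8 → ℝ} (hw : w ∈ E8Lattice) : ∃ n, e8Vec n = w := by
  obtain ⟨y, hy, h₂, h₄⟩ := exists_half_of_mem_E8Lattice hw
  choose n hn using four_dvd_sum_e8TwoRoot_mul h₂ h₄
  refine ⟨n, funext fun i => ?_⟩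
  have h : 4 * e8TwoVec n i = 4 * y i := by
    simp only [e8TwoVec, Finset.mul_sum, ← mul_assoc, ← hn, Finset.sum_mul]
    rw [Finset.sum_comm]
    have : ∀ k j, e8TwoRoot j k * y k * e8TwoWeight j i =
      y k * (e8TwoWeight j i * e8TwoRoot j k) := fun k j => by ring
    simp only [this, ← Finset.mul_sum, sum_e8TwoWeight_mul_e8TwoRoot]
    simp [mul_comm]
  rw [hy, e8Vec, mul_left_cancel₀ four_ne_zero h]

/-- The parametrisation of the lattice by pairings with the simple roots. -/
noncomputable def e8Equiv : (Fin 8 → ℤ) ≃ E8Lattice :=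
  Equiv.ofBijective (fun n => ⟨e8Vec n, e8Vec_mem n⟩) ⟨fun n n' h => by
    refine e8TwoVec_injective (funext fun i => ?_)
    have h' : (e8TwoVec n i : ℝ) / 2 = e8TwoVec n' i / 2 := congrFun (congrArg Subtype.val h) i
    rify
    linarith, fun w => (exists_e8Vec_eq w.2).imp fun _ h => Subtype.ext h⟩

theorem e8Vec_add_e8Cartan (n : Fin 8 → ℤ) (j : Fin 8) :
    e8Vec (n + e8Cartan j) = e8Vec n + e8Root j := by
  ext i
  simp only [e8Vec, e8Root, e8TwoVec, Pi.add_apply, add_mul, Finset.sum_add_distrib,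
    sum_e8Cartan_mul_e8TwoWeight]
  push_cast
  ring

theorem dotR_e8Vec_e8Root (n : Fin 8 → ℤ) (j : Fin 8) : dotR (e8Vec n) (e8Root j) = n j := by
  have h := sum_e8TwoRoot_mul_e8TwoVec n j
  rify at h
  have h' : dotR (e8Vec n) (e8Root j) = (∑ i, (e8TwoRoot j i : ℝ) * e8TwoVec n i) / 4 := by
    rw [dotR, Finset.sum_div]
    refine Finset.sum_congr rfl fun i _ => ?_
    rw [e8Root, e8Vec]
    ring
  rw [h', h]
  ring

theorem dotR_e8Vec_add_e8Cartan (n : Fin 8 → ℤ) (j : Fin 8) :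
    dotR (e8Vec (n + e8Cartan j)) (e8Vec (n + e8Cartan j)) =
      dotR (e8Vec n) (e8Vec n) + 2 * (n j + 1) := by
  have h₁ := dotR_e8Vec_e8Root n j
  have h₂ := dotR_e8Root j j
  rw [e8Cartan_self] at h₂
  have h : dotR (e8Vec (n + e8Cartan j)) (e8Vec (n + e8Cartan j)) = dotR (e8Vec n) (e8Vec n) +
      2 * dotR (e8Vec n) (e8Root j) + dotR (e8Root j) (e8Root j) := by
    simp only [e8Vec_add_e8Cartan, dotR, Finset.mul_sum, ← Finset.sum_add_distrib, Pi.add_apply]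
    exact Finset.sum_congr rfl fun i _ => by ring
  rw [h, h₁, h₂]
  push_cast
  ring

theorem eq_of_forall_add_e8Cartan {γ : Type*} {D : (Fin 8 → ℤ) → γ}
    (hD : ∀ n j, D (n + e8Cartan j) = D n) (n : Fin 8 → ℤ) : D n = D 0 := by
  let S : AddSubgroup (Fin 8 → ℤ) :=
    { carrier := {v | ∀ n, D (n + v) = D n}
      zero_mem' := fun n => by rw [add_zero]
      add_mem' := fun {a b} ha hb n => by rw [← add_assoc, hb, ha]
      neg_mem' := fun {a} ha n => by rw [← ha (n + -a), neg_add_cancel_right] }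
  have hS : ∀ i, Pi.single i (1 : ℤ) ∈ S := fun i => by
    rw [← sum_e8CartanInv_smul_e8Cartan i]
    exact sum_mem fun k _ => S.zsmul_mem (fun n => hD n k) _
  have hn : n ∈ S := by
    rw [pi_eq_sum_univ' n]
    exact sum_mem fun j _ => S.zsmul_mem (hS j) _
  rw [← hn 0, zero_add]

theorem summable_pi_prod {k : ℕ} {h : Fin k → ℤ → ℝ} (h₀ : ∀ i y, 0 ≤ h i y)
    (hs : ∀ i, Summable (h i)) : Summable fun y : Fin k → ℤ => ∏ i, h i (y i) := by
  induction k with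
  | zero => exact (hasSum_fintype _).summable
  | succ k ih =>
    rw [← (Fin.consEquiv fun _ => ℤ).summable_iff]
    have := (hs 0).mul_of_nonneg (ih (h := fun i => h i.succ) (fun i => h₀ _) fun i => hs _)
      (h₀ 0) fun y => Finset.prod_nonneg fun i _ => h₀ _ _
    refine this.congr fun p => ?_
    simp [Fin.prod_univ_succ, Fin.consEquiv]

theorem summable_thetaE8_term {τ : ℂ} (hτ : 0 < τ.im) (m : Fin 8 → ℂ) :
    Summable fun n : Fin 8 → ℤ => Complex.exp (Real.pi * Complex.I * τ *
      (dotR (e8Vec n) (e8Vec n) : ℂ) + 2 * Real.pi * Complex.I * dotC m (e8Vec n)) := by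
  have hτ' : 0 < (τ / 4).im := by
    rw [show τ / 4 = τ / (4 : ℝ) by simp, Complex.div_ofReal_im]
    positivity
  have h := (summable_pi_prod (h := fun i y => ‖jacobiTheta₂_term y (m i / 2) (τ / 4)‖)
    (fun _ _ => norm_nonneg _)
    fun i => ((summable_jacobiTheta₂_term_iff _ _).mpr hτ').norm).comp_injective
      e8TwoVec_injective
  refine Summable.of_norm (h.congr fun n => ?_)
  simp only [Function.comp_apply]
  rw [← norm_prod]
  congr 1
  simp only [jacobiTheta₂_term, ← Complex.exp_sum, dotR, dotC, e8Vec]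
  push_cast
  rw [Finset.mul_sum, Finset.mul_sum, ← Finset.sum_add_distrib]
  congr 1
  exact Finset.sum_congr rfl fun i _ => by ring

end Lattice

section Blowup

open Complex

/-- The functional equation attached to `α`. -/
def BlowupEquation (τ : ℂ) (f : (Fin 8 → ℂ) → ℂ) (α : Fin 8 → ℝ) : Prop :=
  ∀ m : Fin 8 → ℂ, ∀ ε₁ ε₂ : ℂ,
    theta1 τ ε₂ * theta1 τ (dotC m α + ε₂) * f (m + ε₁ • (fun i => (α i : ℂ))) -
      theta1 τ ε₁ * theta1 τ (dotC m α + ε₁) * f (m + ε₂ • (fun i => (α i : ℂ))) =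
    theta1 τ (ε₂ - ε₁) * theta1 τ (dotC m α + ε₁ + ε₂) * f m

variable {τ : ℂ} {f : (Fin 8 → ℂ) → ℂ} {α : Fin 8 → ℝ}

theorem BlowupEquation.add_root (h : BlowupEquation τ f α) (hτ : 0 < τ.im) (m : Fin 8 → ℂ) :
    f (m + fun i => (α i : ℂ)) = f m := by
  obtain ⟨ε, hε⟩ := exists_theta1_mul_theta1_ne_zero hτ (dotC m α)
  have h₁ : theta1 τ 1 = 0 := by simpa [theta1_zero] using theta1_add_one τ 0
  have h₂ := h m 1 ε
  rw [h₁, one_smul, theta1_sub_one, add_right_comm _ 1 ε, theta1_add_one τ (_ + ε)] at h₂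
  refine mul_left_cancel₀ hε ?_
  linear_combination h₂

theorem BlowupEquation.add_tau_smul_root (h : BlowupEquation τ f α) (hτ : 0 < τ.im)
    (m : Fin 8 → ℂ) : f (m + τ • fun i => (α i : ℂ)) =
      exp (-(2 * Real.pi * I * (τ + dotC m α))) * f m := by
  obtain ⟨ε, hε⟩ := exists_theta1_mul_theta1_ne_zero hτ (dotC m α)
  have h₁ : theta1 τ τ = 0 := by simpa [theta1_zero] using theta1_add_tau τ 0
  have h₂ := h m τ ε
  rw [h₁, theta1_sub_tau, add_right_comm _ τ ε, theta1_add_tau τ (_ + ε)] at h₂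
  have h₃ : exp (-Real.pi * I * τ + 2 * Real.pi * I * ε) *
      exp (-Real.pi * I * τ - 2 * Real.pi * I * (dotC m α + ε)) =
      exp (-(2 * Real.pi * I * (τ + dotC m α))) := by
    rw [← exp_add]
    congr 1
    ring
  rw [← h₃]
  refine mul_left_cancel₀ hε ?_
  linear_combination h₂

/-- The point of `ℂ⁸` with given coordinates with respect to the simple roots. -/
noncomputable def rootCombination (z : Fin 8 → ℂ) (i : Fin 8) : ℂ := ∑ j, z j * (e8Root j i : ℂ)

theorem rootCombination_add_smul_single (z : Fin 8 → ℂ) (s : ℂ) (j : Fin 8) :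
    rootCombination (z + s • Pi.single j 1) =
      rootCombination z + s • fun i => (e8Root j i : ℂ) := by
  ext i
  simp [rootCombination, add_mul, Finset.sum_add_distrib, Pi.single_apply]

theorem dotC_rootCombination (z : Fin 8 → ℂ) (j : Fin 8) :
    dotC (rootCombination z) (e8Root j) = ∑ k, (e8Cartan j k : ℂ) * z k := by
  simp only [dotC, rootCombination, Finset.sum_mul]
  rw [Finset.sum_comm]
  refine Finset.sum_congr rfl fun k _ => ?_
  have h : ((dotR (e8Root j) (e8Root k) : ℝ) : ℂ) = e8Cartan j k := by
    rw [dotR_e8Root]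
    simp
  rw [← h, dotR]
  push_cast
  rw [Finset.sum_mul]
  exact Finset.sum_congr rfl fun i _ => by ring

/-- The coordinates of a point of `ℂ⁸` with respect to the simple roots. -/
noncomputable def rootCoordinate (m : Fin 8 → ℂ) (j : Fin 8) : ℂ :=
  dotC m fun i => e8TwoWeight j i / 2

theorem rootCombination_rootCoordinate (m : Fin 8 → ℂ) :
    rootCombination (rootCoordinate m) = m := by
  ext i
  simp only [rootCombination, rootCoordinate, dotC, Finset.sum_mul, e8Root]
  rw [Finset.sum_comm]
  have h : ∀ k, ∑ j, m k * ((e8TwoWeight j k / 2 : ℝ) : ℂ) * ((e8TwoRoot j i / 2 : ℝ) : ℂ) =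
      m k * (((∑ j, e8TwoWeight j k * e8TwoRoot j i : ℤ) : ℂ) / 4) := fun k => by
    push_cast
    rw [Finset.sum_div, Finset.mul_sum]
    exact Finset.sum_congr rfl fun j _ => by ring
  simp only [h, sum_e8TwoWeight_mul_e8TwoRoot]
  simp [ite_div]

theorem sum_mul_rootCoordinate (n : Fin 8 → ℤ) (m : Fin 8 → ℂ) :
    ∑ j, (n j : ℂ) * rootCoordinate m j = dotC m (e8Vec n) := by
  simp only [rootCoordinate, dotC, e8Vec, e8TwoVec, Finset.mul_sum]
  rw [Finset.sum_comm]
  refine Finset.sum_congr rfl fun i _ => ?_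
  push_cast
  rw [Finset.sum_div, Finset.mul_sum]
  exact Finset.sum_congr rfl fun j _ => by ring

theorem entireCoeff_eq_of_blowupEquation (hτ : 0 < τ.im)
    (hF : IsUnitPeriodic fun z => f (rootCombination z))
    (hd : Differentiable ℂ fun z => f (rootCombination z))
    (h : ∀ j, BlowupEquation τ f (e8Root j)) (n : Fin 8 → ℤ) :
    entireCoeff (fun z => f (rootCombination z)) n 0 =
      entireCoeff (fun z => f (rootCombination z)) 0 0 *
        exp (Real.pi * I * τ * (dotR (e8Vec n) (e8Vec n) : ℂ)) := by
  have hinv := eq_of_forall_add_e8Cartan (D := fun n =>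
    entireCoeff (fun z => f (rootCombination z)) n 0 *
      exp (-(Real.pi * I * τ * (dotR (e8Vec n) (e8Vec n) : ℂ)))) (fun n j => ?_) n
  · have h₀ : dotR (e8Vec 0) (e8Vec 0) = 0 := by simp [dotR, e8Vec, e8TwoVec]
    simp only [h₀, ofReal_zero, mul_zero, neg_zero, exp_zero, mul_one] at hinv
    rw [← hinv, mul_assoc, ← exp_add, neg_add_cancel, exp_zero, mul_one]
  · have hq : ∀ z, f (rootCombination (z + τ • Pi.single j 1)) =
        exp (-(2 * Real.pi * I * (τ + ∑ k, (e8Cartan j k : ℂ) * z k))) *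
          f (rootCombination z) := fun z => by
      rw [rootCombination_add_smul_single, (h j).add_tau_smul_root hτ, dotC_rootCombination]
    rw [entireCoeff_add_of_quasiperiodic hF hd hq, dotR_e8Vec_add_e8Cartan, mul_right_comm,
      ← exp_add, mul_comm]
    congr 2
    push_cast
    ring

end Blowup

/-- A holomorphic function f on ℂ⁸ satisfying the blowup functional equation
for every root α of the E₈ lattice is a multiple of the E₈ theta function. -/
theorem statement5 (τ : ℂ) (hτ : 0 < τ.im)
    (f : (Fin 8 → ℂ) → ℂ) (hf : Differentiable ℂ f)
    (heq : ∀ α ∈ E8Lattice, dotR α α = 2 → ∀ m : Fin 8 → ℂ, ∀ ε₁ ε₂ : ℂ,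
      theta1 τ ε₂ * theta1 τ (dotC m α + ε₂) * f (m + ε₁ • (fun i => (α i : ℂ))) -
        theta1 τ ε₁ * theta1 τ (dotC m α + ε₁) * f (m + ε₂ • (fun i => (α i : ℂ))) =
      theta1 τ (ε₂ - ε₁) * theta1 τ (dotC m α + ε₁ + ε₂) * f m) :
    ∃ c : ℂ, ∀ m : Fin 8 → ℂ, f m = c * ThetaE8 τ m := by
  have hα : ∀ j, BlowupEquation τ f (e8Root j) := fun j =>
    heq _ (e8Root_mem j) (by rw [dotR_e8Root, e8Cartan_self]; norm_num)
  have hF : IsUnitPeriodic fun z => f (rootCombination z) := fun z j => by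
    have h := rootCombination_add_smul_single z 1 j
    rw [one_smul, one_smul] at h
    simp only [h, (hα j).add_root hτ]
  have hd : Differentiable ℂ fun z => f (rootCombination z) := by
    refine hf.comp ?_
    unfold rootCombination
    fun_prop
  refine ⟨entireCoeff (fun z => f (rootCombination z)) 0 0, fun m => ?_⟩
  have hterm : ∀ n : Fin 8 → ℤ, entireCoeff (fun z => f (rootCombination z)) n 0 *
      Complex.exp (2 * Real.pi * Complex.I * ∑ i, n i * rootCoordinate m i) =
      entireCoeff (fun z => f (rootCombination z)) 0 0 * Complex.exp (Real.pi * Complex.I * τ *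
        (dotR (e8Vec n) (e8Vec n) : ℂ) + 2 * Real.pi * Complex.I * dotC m (e8Vec n)) := by
    intro n
    rw [entireCoeff_eq_of_blowupEquation hτ hF hd hα, sum_mul_rootCoordinate, Complex.exp_add,
      mul_assoc]
  have hsum := hasSum_entireCoeff hF hd (rootCoordinate m)
    (by simpa only [hterm] using (summable_thetaE8_term hτ m).mul_left _)
  simp only [hterm, rootCombination_rootCoordinate] at hsum
  rw [← hsum.tsum_eq, tsum_mul_left, ThetaE8, ← e8Equiv.tsum_eq]
  rfl
end

section
/- The E₈ theta function satisfies the following functional equation (the unity blowup equation of the E--string theory at base degree one): for every root α of the E₈ lattice Λ_{E₈}, every τ in the upper half-plane ℍ, every m ∈ ℂ⁸ and all ε₁, ε₂ ∈ ℂ, θ₁(τ, ε₂)·θ₁(τ, α·m + ε₂)·Θ_{E₈}(τ, m + ε₁α) − θ₁(τ, ε₁)·θ₁(τ, α·m + ε₁)·Θ_{E₈}(τ, m + ε₂α) = θ₁(τ, ε₂ − ε₁)·θ₁(τ, α·m + ε₁ + ε₂)·Θ_{E₈}(τ, m). -/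
open Complex in
/-- The theta series in one variable with characteristic `c`. -/
noncomputable def charTheta (τ c z : ℂ) : ℂ :=
  ∑' n : ℤ, cexp (Real.pi * I * τ * ((n : ℂ) + c) ^ 2 + 2 * Real.pi * I * ((n : ℂ) + c) * z)

section CharTheta

open Complex

theorem summable_charTheta_term {τ : ℂ} (hτ : 0 < τ.im) (c z : ℂ) :
    Summable fun n : ℤ =>
      cexp (Real.pi * I * τ * ((n : ℂ) + c) ^ 2 + 2 * Real.pi * I * ((n : ℂ) + c) * z) := by
  refine (((summable_jacobiTheta₂_term_iff (z + τ * c) τ).2 hτ).mul_left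
    (cexp (Real.pi * I * τ * c ^ 2 + 2 * Real.pi * I * c * z))).congr fun n => ?_
  rw [jacobiTheta₂_term, ← Complex.exp_add]
  congr 1
  ring

/-- The change of variables `(n, m) ↦ ((n + m) / 2, (n - m) / 2)`, split by the parity of `n - m`. -/
theorem bijective_sum_diff_int :
    Function.Bijective (Sum.elim (fun p : ℤ × ℤ => (p.1 + p.2, p.1 - p.2))
      (fun p : ℤ × ℤ => (p.1 + p.2, p.1 - p.2 - 1))) := by
  constructor
  · rintro (⟨a, b⟩ | ⟨a, b⟩) (⟨c, d⟩ | ⟨c, d⟩) h <;>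
      simp only [Sum.elim_inl, Sum.elim_inr, Prod.mk.injEq, Sum.inl.injEq, Sum.inr.injEq,
        reduceCtorEq] at h ⊢ <;> omega
  · rintro ⟨n, m⟩
    rcases Int.even_or_odd' (n - m) with ⟨q, hq | hq⟩
    · exact ⟨.inl (m + q, q), by simp only [Sum.elim_inl, Prod.mk.injEq]; omega⟩
    · exact ⟨.inr (m + q + 1, q), by simp only [Sum.elim_inr, Prod.mk.injEq]; omega⟩

/-- The addition formula for theta series. -/
theorem charTheta_mul_charTheta {τ : ℂ} (hτ : 0 < τ.im) (c u v : ℂ) :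
    charTheta τ c u * charTheta τ c v =
      charTheta (2 * τ) c (u + v) * charTheta (2 * τ) 0 (u - v) +
      charTheta (2 * τ) (c - 1 / 2) (u + v) * charTheta (2 * τ) (1 / 2) (u - v) := by
  have h2 : 0 < (2 * τ).im := by simpa using hτ
  have hs (c z : ℂ) := (summable_charTheta_term hτ c z).norm
  have hs2 (c z : ℂ) := (summable_charTheta_term h2 c z).norm
  have key (c₁ z₁ c₂ z₂ : ℂ) := (summable_mul_of_summable_norm (hs2 c₁ z₁) (hs2 c₂ z₂)).hasSum
  simp only [charTheta]
  rw [tsum_mul_tsum_of_summable_norm (hs c u) (hs c v),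
    tsum_mul_tsum_of_summable_norm (hs2 c _) (hs2 0 _),
    tsum_mul_tsum_of_summable_norm (hs2 _ _) (hs2 (1 / 2) _),
    ← (Equiv.ofBijective _ bijective_sum_diff_int).tsum_eq]
  refine (HasSum.sum ?_ ?_).tsum_eq
  · convert key c (u + v) 0 (u - v) using 2 with p
    simp only [Function.comp_apply, Equiv.ofBijective_apply, Sum.elim_inl, ← Complex.exp_add]
    congr 1
    push_cast
    ring
  · convert key (c - 1 / 2) (u + v) (1 / 2) (u - v) using 2 with p
    simp only [Function.comp_apply, Equiv.ofBijective_apply, Sum.elim_inr, ← Complex.exp_add]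
    congr 1
    push_cast
    ring

theorem charTheta_zero_add_one (τ z : ℂ) : charTheta τ 0 (z + 1) = charTheta τ 0 z := by
  refine tsum_congr fun n => ?_
  rw [Complex.exp_eq_exp_iff_exists_int]
  exact ⟨n, by ring⟩

theorem charTheta_half_add_one (τ z : ℂ) :
    charTheta τ (1 / 2) (z + 1) = -charTheta τ (1 / 2) z := by
  rw [charTheta, charTheta, ← tsum_neg]
  refine tsum_congr fun n => ?_
  rw [neg_eq_neg_one_mul, ← Complex.exp_pi_mul_I, ← Complex.exp_add,
    Complex.exp_eq_exp_iff_exists_int]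
  exact ⟨n, by ring⟩

theorem theta1_eq_neg_charTheta (τ z : ℂ) : theta1 τ z = -charTheta τ (1 / 2) (z + 1 / 2) := by
  rw [theta1, charTheta, ← tsum_mul_left, ← tsum_neg]
  refine tsum_congr fun n => ?_
  have hI : cexp (Real.pi / 2 * I) = I := Complex.exp_pi_div_two_mul_I
  have h : cexp (Real.pi * I * τ * ((n : ℂ) + 1 / 2) ^ 2 +
      2 * Real.pi * I * ((n : ℂ) + 1 / 2) * (z + 1 / 2)) =
      cexp (Real.pi * I) ^ n * cexp (Real.pi / 2 * I) *
        cexp (Real.pi * I * τ * ((n : ℂ) + 1 / 2) ^ 2 +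
          2 * Real.pi * I * ((n : ℂ) + 1 / 2) * z) := by
    rw [← Complex.exp_int_mul, ← Complex.exp_add, ← Complex.exp_add]
    congr 1
    ring
  rw [h, hI, Complex.exp_pi_mul_I]
  ring

theorem theta1_mul_theta1 {τ : ℂ} (hτ : 0 < τ.im) (u v : ℂ) :
    theta1 τ u * theta1 τ v =
      charTheta (2 * τ) 0 (u + v) * charTheta (2 * τ) (1 / 2) (u - v) -
      charTheta (2 * τ) (1 / 2) (u + v) * charTheta (2 * τ) 0 (u - v) := by
  rw [theta1_eq_neg_charTheta, theta1_eq_neg_charTheta, neg_mul_neg,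
    charTheta_mul_charTheta hτ, sub_self, add_sub_add_right_eq_sub,
    show u + 1 / 2 + (v + 1 / 2) = u + v + 1 by ring, charTheta_zero_add_one,
    charTheta_half_add_one]
  ring

/-- Three-term relation for theta series of characteristic `0` or `1 / 2`. -/
theorem theta1_three_term {τ : ℂ} (hτ : 0 < τ.im) (a ε₁ ε₂ : ℂ) {c : ℂ}
    (hc : c = 0 ∨ c = 1 / 2) :
    theta1 τ ε₂ * theta1 τ (a + ε₂) * charTheta (2 * τ) c (a + 2 * ε₁) -
      theta1 τ ε₁ * theta1 τ (a + ε₁) * charTheta (2 * τ) c (a + 2 * ε₂) =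
    theta1 τ (ε₂ - ε₁) * theta1 τ (a + ε₁ + ε₂) * charTheta (2 * τ) c a := by
  have h (ε : ℂ) := theta1_mul_theta1 hτ (a + ε) ε
  rw [mul_comm (theta1 τ ε₂), mul_comm (theta1 τ ε₁), mul_comm (theta1 τ (ε₂ - ε₁)),
    h, h, theta1_mul_theta1 hτ,
    show a + ε₁ + ε₂ + (ε₂ - ε₁) = a + 2 * ε₂ by ring,
    show a + ε₁ + ε₂ - (ε₂ - ε₁) = a + 2 * ε₁ by ring,
    show a + ε₁ + ε₁ = a + 2 * ε₁ by ring, show a + ε₂ + ε₂ = a + 2 * ε₂ by ring,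
    add_sub_cancel_right, add_sub_cancel_right]
  rcases hc with rfl | rfl <;> ring

end CharTheta

section Lattice

theorem mem_E8Lattice_iff {x : Fin 8 → ℝ} :
    x ∈ E8Lattice ↔ ∃ (a : Fin 8 → ℤ) (s k : ℤ),
      (∀ i, x i = a i + s / 2) ∧ ∑ i, a i = 2 * k := by
  constructor
  · rintro ⟨h | h, k, hk⟩ <;> choose a ha using h
    · refine ⟨a, 0, k, by simpa using ha, ?_⟩
      simp only [ha] at hk
      exact_mod_cast hk
    · refine ⟨a, 1, k - 2, by simpa using ha, ?_⟩
      simp only [ha, Finset.sum_add_distrib, Finset.sum_const, Finset.card_univ,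
        Fintype.card_fin] at hk
      have : ((∑ i, a i : ℤ) : ℝ) = ((2 * (k - 2) : ℤ) : ℝ) := by
        push_cast
        norm_num at hk
        linarith
      exact_mod_cast this
  · rintro ⟨a, s, k, ha, hk⟩
    refine ⟨?_, k + 2 * s, ?_⟩
    · rcases Int.even_or_odd' s with ⟨t, rfl | rfl⟩
      · exact .inl fun i => ⟨a i + t, by rw [ha]; push_cast; ring⟩
      · exact .inr fun i => ⟨a i + t, by rw [ha]; push_cast; ring⟩
    · have hk' : ∑ i, (a i : ℝ) = 2 * k := by exact_mod_cast hk
      simp only [ha, Finset.sum_add_distrib, hk', Finset.sum_const, Finset.card_univ,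
        Fintype.card_fin]
      push_cast
      norm_num
      ring

theorem add_zsmul_mem_E8Lattice {x y : Fin 8 → ℝ} (hx : x ∈ E8Lattice) (hy : y ∈ E8Lattice)
    (n : ℤ) : x + (n : ℝ) • y ∈ E8Lattice := by
  rw [mem_E8Lattice_iff] at *
  obtain ⟨a, s, k, ha, hk⟩ := hx
  obtain ⟨b, t, l, hb, hl⟩ := hy
  refine ⟨fun i => a i + n * b i, s + n * t, k + n * l, fun i => ?_, ?_⟩
  · simp only [Pi.add_apply, Pi.smul_apply, smul_eq_mul, ha, hb]
    push_cast
    ring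
  · rw [Finset.sum_add_distrib, ← Finset.mul_sum, hk, hl]
    ring

theorem exists_int_dotR_eq {x y : Fin 8 → ℝ} (hx : x ∈ E8Lattice) (hy : y ∈ E8Lattice) :
    ∃ k : ℤ, dotR x y = k := by
  rw [mem_E8Lattice_iff] at *
  obtain ⟨a, s, k, ha, hk⟩ := hx
  obtain ⟨b, t, l, hb, hl⟩ := hy
  have hk' : ∑ i, (a i : ℝ) = 2 * k := by exact_mod_cast hk
  have hl' : ∑ i, (b i : ℝ) = 2 * l := by exact_mod_cast hl
  refine ⟨∑ i, a i * b i + t * k + s * l + 2 * s * t, ?_⟩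
  have h (i : Fin 8) : x i * y i =
      a i * b i + (t / 2 : ℝ) * a i + (s / 2 : ℝ) * b i + s * t / 4 := by
    rw [ha, hb]
    ring
  simp only [dotR, h, Finset.sum_add_distrib, ← Finset.mul_sum, hk', hl', Finset.sum_const,
    Finset.card_univ, Fintype.card_fin]
  push_cast
  norm_num
  ring

theorem dotR_add_smul_left (x y z : Fin 8 → ℝ) (r : ℝ) :
    dotR (x + r • y) z = dotR x z + r * dotR y z := by
  simp only [dotR, Pi.add_apply, Pi.smul_apply, smul_eq_mul, Finset.mul_sum,
    ← Finset.sum_add_distrib]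
  exact Finset.sum_congr rfl fun i _ => by ring

theorem dotR_comm (x y : Fin 8 → ℝ) : dotR x y = dotR y x :=
  Finset.sum_congr rfl fun _ _ => mul_comm _ _

theorem dotC_add_smul (m : Fin 8 → ℂ) (ε : ℂ) (x y z : Fin 8 → ℝ) (r : ℝ) :
    dotC (m + ε • fun i => (z i : ℂ)) (x + r • y) =
      dotC m x + r * dotC m y + ε * (dotR x z + r * dotR y z : ℝ) := by
  simp only [dotC, dotR, Pi.add_apply, Pi.smul_apply, smul_eq_mul, Finset.mul_sum,
    ← Finset.sum_add_distrib, Complex.ofReal_sum]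
  refine Finset.sum_congr rfl fun i _ => ?_
  push_cast
  ring

/-- Representatives of the lattice `E₈` modulo the multiples of `α`. -/
abbrev E8Rep (α : Fin 8 → ℝ) : Type :=
  {w : E8Lattice // dotR w α = 0 ∨ dotR w α = 1}

theorem bijective_add_zsmul_root {α : Fin 8 → ℝ} (hα : α ∈ E8Lattice) (hroot : dotR α α = 2) :
    Function.Bijective fun p : E8Rep α × ℤ =>
      (⟨p.1.1 + (p.2 : ℝ) • α, add_zsmul_mem_E8Lattice p.1.1.2 hα p.2⟩ : E8Lattice) := by
  constructor
  · rintro ⟨⟨⟨w, hw⟩, hd⟩, n⟩ ⟨⟨⟨w', hw'⟩, hd'⟩, n'⟩ h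
    simp only [Subtype.mk.injEq] at h hd hd'
    have hdot := congrArg (dotR · α) h
    simp only [dotR_add_smul_left, hroot] at hdot
    have hn : n = n' := by
      rcases hd with hd | hd <;> rcases hd' with hd' | hd' <;> rw [hd, hd'] at hdot <;>
        norm_cast at hdot <;> omega
    subst hn
    simpa using h
  · rintro ⟨w, hw⟩
    obtain ⟨k, hk⟩ := exists_int_dotR_eq hw hα
    have hmem := add_zsmul_mem_E8Lattice hw hα (-(k / 2))
    refine ⟨⟨⟨⟨_, hmem⟩, ?_⟩, k / 2⟩, ?_⟩
    · simp only [dotR_add_smul_left, hroot, hk]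
      norm_cast
      omega
    · ext i
      simp

theorem summable_prod_pi {ι : Type*} {n : ℕ} {f : Fin n → ι → ℝ} (hf : ∀ i, Summable (f i))
    (h0 : ∀ i j, 0 ≤ f i j) : Summable fun v : Fin n → ι => ∏ i, f i (v i) := by
  induction n with
  | zero => exact Summable.of_finite
  | succ n ih =>
    rw [← (Fin.consEquiv fun _ => ι).summable_iff]
    refine ((hf 0).mul_of_nonneg (ih (fun i => hf i.succ) fun i => h0 i.succ) (h0 0)
      fun v => Finset.prod_nonneg fun i _ => h0 _ _).congr fun p => ?_
    simp [Fin.prod_univ_succ, Fin.consEquiv]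

open Complex in
theorem summable_ThetaE8_term {τ : ℂ} (hτ : 0 < τ.im) (m : Fin 8 → ℂ) :
    Summable fun w : E8Lattice => cexp (Real.pi * I * τ * (dotR w w : ℂ) +
      2 * Real.pi * I * dotC m (w : Fin 8 → ℝ)) := by
  have hhalf (w : E8Lattice) : ∃ v : Fin 8 → ℤ, ∀ i, (w : Fin 8 → ℝ) i = v i / 2 := by
    obtain ⟨a, s, k, ha, -⟩ := mem_E8Lattice_iff.1 w.2
    exact ⟨fun i => 2 * a i + s, fun i => by rw [ha]; push_cast; ring⟩
  choose v hv using hhalf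
  have hinj : Function.Injective v := fun w w' h => by
    ext i
    rw [hv, hv, h]
  have h4 : 0 < (τ / 4).im := by
    rw [show τ / 4 = τ * ((1 / 4 : ℝ) : ℂ) by push_cast; ring, Complex.im_mul_ofReal]
    positivity
  have hsum := summable_prod_pi
    (fun i => ((summable_jacobiTheta₂_term_iff (m i / 2) (τ / 4)).2 h4).norm)
    fun _ _ => norm_nonneg _
  refine Summable.of_norm ((hsum.comp_injective hinj).congr fun w => ?_)
  simp only [Function.comp_apply, jacobiTheta₂_term]
  rw [← norm_prod, ← Complex.exp_sum]
  congr 2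
  simp only [dotR, dotC, hv, Complex.ofReal_sum, Finset.mul_sum, ← Finset.sum_add_distrib]
  refine Finset.sum_congr rfl fun i _ => ?_
  push_cast
  ring

open Complex in
/-- Expansion of the `E₈` theta function along the direction of a root. -/
theorem hasSum_ThetaE8_add_smul {α : Fin 8 → ℝ} (hα : α ∈ E8Lattice) (hroot : dotR α α = 2)
    {τ : ℂ} (hτ : 0 < τ.im) (m : Fin 8 → ℂ) (ε : ℂ) :
    HasSum (fun w : E8Rep α =>
      cexp (Real.pi * I * τ * (dotR w.1 w.1 - dotR w.1 α ^ 2 / 2) +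
        2 * Real.pi * I * (dotC m w.1 - dotR w.1 α / 2 * dotC m α)) *
        charTheta (2 * τ) (dotR w.1 α / 2) (dotC m α + 2 * ε))
      (ThetaE8 τ (m + ε • fun i => (α i : ℂ))) := by
  have h2 : 0 < (2 * τ).im := by simpa using hτ
  have h := (summable_ThetaE8_term hτ (m + ε • fun i => (α i : ℂ))).hasSum
  rw [← (Equiv.ofBijective _ (bijective_add_zsmul_root hα hroot)).hasSum_iff] at h
  refine h.prod_fiberwise fun w => ?_
  refine ((summable_charTheta_term h2 (dotR w.1 α / 2) (dotC m α + 2 * ε)).hasSum.mul_left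
    _).congr_fun fun n => ?_
  simp only [Function.comp_apply, Equiv.ofBijective_apply]
  rw [← Complex.exp_add, dotC_add_smul, dotR_add_smul_left, dotR_comm w.1.1 (w.1.1 + _),
    dotR_comm α (w.1.1 + _), dotR_add_smul_left, dotR_add_smul_left, dotR_comm α w.1.1, hroot]
  congr 1
  push_cast
  ring

end Lattice

/-- The unity blowup equation of the E--string theory at base degree one:
a functional equation satisfied by the E₈ theta function for every root α. -/
theorem statement6 (α : Fin 8 → ℝ) (hα : α ∈ E8Lattice) (hroot : dotR α α = 2)
    (τ : ℂ) (hτ : 0 < τ.im) (m : Fin 8 → ℂ) (ε₁ ε₂ : ℂ) :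
    theta1 τ ε₂ * theta1 τ (dotC m α + ε₂) * ThetaE8 τ (m + ε₁ • (fun i => (α i : ℂ))) -
      theta1 τ ε₁ * theta1 τ (dotC m α + ε₁) * ThetaE8 τ (m + ε₂ • (fun i => (α i : ℂ))) =
    theta1 τ (ε₂ - ε₁) * theta1 τ (dotC m α + ε₁ + ε₂) * ThetaE8 τ m := by
  have h (ε : ℂ) := hasSum_ThetaE8_add_smul hα hroot hτ m ε
  have h0 := h 0
  simp only [zero_smul, mul_zero, add_zero] at h0
  refine (((h ε₁).mul_left _).sub ((h ε₂).mul_left _)).unique ?_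
  refine (h0.mul_left _).congr_fun fun w => ?_
  have hc : (dotR w.1 α / 2 : ℂ) = 0 ∨ (dotR w.1 α / 2 : ℂ) = 1 / 2 := by
    rcases w.2 with hw | hw <;> simp [hw]
  linear_combination Complex.exp (Real.pi * Complex.I * τ * (dotR w.1 w.1 - dotR w.1 α ^ 2 / 2) +
    2 * Real.pi * Complex.I * (dotC m w.1 - dotR w.1 α / 2 * dotC m α)) *
    theta1_three_term hτ (dotC m α) ε₁ ε₂ hc
end

section
/- The E₈ theta function decomposes as a sum of products of Jacobi theta functions: for every τ in the upper half-plane ℍ and every m = (m₁, …, m₈) ∈ ℂ⁸, Θ_{E₈}(τ, m) = (1/2)·(∏_{ℓ=1}^8 θ₁(τ, m_ℓ) + ∏_{ℓ=1}^8 θ₂(τ, m_ℓ) + ∏_{ℓ=1}^8 θ₃(τ, m_ℓ) + ∏_{ℓ=1}^8 θ₄(τ, m_ℓ)). -/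
/-- The Jacobi theta function θ₂(τ,z). -/
noncomputable def theta2 (τ z : ℂ) : ℂ :=
  ∑' n : ℤ, Complex.exp (Real.pi * Complex.I * τ * ((n : ℂ) + 1 / 2) ^ 2 +
    2 * Real.pi * Complex.I * ((n : ℂ) + 1 / 2) * z)

/-- The Jacobi theta function θ₃(τ,z). -/
noncomputable def theta3 (τ z : ℂ) : ℂ :=
  ∑' n : ℤ, Complex.exp (Real.pi * Complex.I * τ * (n : ℂ) ^ 2 +
    2 * Real.pi * Complex.I * (n : ℂ) * z)

/-- The Jacobi theta function θ₄(τ,z). -/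
noncomputable def theta4 (τ z : ℂ) : ℂ :=
  ∑' n : ℤ, (-1 : ℂ) ^ n * Complex.exp (Real.pi * Complex.I * τ * (n : ℂ) ^ 2 +
    2 * Real.pi * Complex.I * (n : ℂ) * z)

/-- The product of finitely many absolutely convergent series is the sum over all multi-indices. -/
theorem hasSum_prod_fin_of_summable_norm {ι : Type*} {k : ℕ} (f : Fin k → ι → ℂ)
    (hf : ∀ i, Summable fun n => ‖f i n‖) :
    (Summable fun v : Fin k → ι => ‖∏ i, f i (v i)‖) ∧
      HasSum (fun v : Fin k → ι => ∏ i, f i (v i)) (∏ i, ∑' n, f i n) := by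
  induction k with
  | zero =>
    refine ⟨(hasSum_fintype _).summable, ?_⟩
    simp
  | succ k ih =>
    obtain ⟨hs, hp⟩ := ih (fun i => f i.succ) fun i => hf i.succ
    have hn := Summable.mul_norm (hf 0) hs
    constructor
    · refine (Fin.consEquiv fun _ => ι).summable_iff.mp (hn.congr fun p => ?_)
      simp [Fin.prod_univ_succ, Fin.consEquiv]
    · rw [Fin.prod_univ_succ]
      refine (Fin.consEquiv fun _ => ι).hasSum_iff.mp ?_
      refine ((hf 0).of_norm.hasSum.mul hp hn.of_norm).congr_fun fun p => ?_
      simp [Fin.prod_univ_succ, Fin.consEquiv]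

/-- The general term of a theta series with characteristic `c`. -/
noncomputable def thetaTerm (τ : ℂ) (c : ℝ) (z : ℂ) (n : ℤ) : ℂ :=
  Complex.exp (Real.pi * Complex.I * τ * ((n : ℂ) + c) ^ 2 +
    2 * Real.pi * Complex.I * ((n : ℂ) + c) * z)

theorem summable_norm_thetaTerm {τ : ℂ} (hτ : 0 < τ.im) (c : ℝ) (z : ℂ) :
    Summable fun n => ‖thetaTerm τ c z n‖ := by
  have h := ((summable_jacobiTheta₂_term_iff (z + c * τ) τ).mpr hτ).norm.mul_left
    ‖Complex.exp (Real.pi * Complex.I * τ * c ^ 2 + 2 * Real.pi * Complex.I * c * z)‖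
  refine h.congr fun n => ?_
  rw [← norm_mul, jacobiTheta₂_term, ← Complex.exp_add, thetaTerm]
  congr 2
  ring

theorem neg_one_zpow_sum {ι : Type*} (s : Finset ι) (v : ι → ℤ) :
    ∏ i ∈ s, (-1 : ℂ) ^ v i = (-1) ^ ∑ i ∈ s, v i := by
  classical
  induction s using Finset.induction_on with
  | empty => simp
  | insert a s ha ih =>
    rw [Finset.prod_insert ha, Finset.sum_insert ha, ih, zpow_add₀ (by norm_num)]

/-- The theta series of the translate by `(c, …, c)` of the even-sum sublattice of `ℤᵏ`. -/
theorem hasSum_prod_thetaTerm_even {τ : ℂ} (hτ : 0 < τ.im) (c : ℝ) {k : ℕ} (m : Fin k → ℂ) :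
    HasSum (fun v : {v : Fin k → ℤ | Even (∑ i, v i)} => ∏ i, thetaTerm τ c (m i) (v.1 i))
      (1 / 2 * ((∏ i, ∑' n, thetaTerm τ c (m i) n) +
        ∏ i, ∑' n : ℤ, (-1 : ℂ) ^ n * thetaTerm τ c (m i) n)) := by
  have hpos := (hasSum_prod_fin_of_summable_norm (fun i => thetaTerm τ c (m i))
    fun i => summable_norm_thetaTerm hτ c (m i)).2
  have hneg := (hasSum_prod_fin_of_summable_norm
    (fun i (n : ℤ) => (-1 : ℂ) ^ n * thetaTerm τ c (m i) n)
    fun i => (summable_norm_thetaTerm hτ c (m i)).congr fun n => by simp).2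
  refine (hasSum_subtype_iff_indicator
    (f := fun v : Fin k → ℤ => ∏ i, thetaTerm τ c (m i) (v i))).mpr ?_
  refine ((hpos.add hneg).mul_left (1 / 2)).congr_fun fun v => ?_
  rw [Finset.prod_mul_distrib, neg_one_zpow_sum]
  by_cases h : Even (∑ i, v i)
  · rw [Set.indicator_of_mem (by exact h), h.neg_one_zpow]
    ring
  · rw [Set.indicator_of_notMem (by exact h), (Int.not_even_iff_odd.mp h).neg_one_zpow]
    ring

/-- The translate of an even-sum integer vector by `(c, …, c)`, as an element of the `E₈` lattice. -/
noncomputable def E8Lattice.translate (c : ℝ) (hc : c = 0 ∨ c = 1 / 2)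
    (v : {v : Fin 8 → ℤ | Even (∑ i, v i)}) : E8Lattice :=
  ⟨fun i => v.1 i + c, by
    obtain ⟨v, a, ha⟩ := v
    have hsum : ∑ i, (v i : ℝ) = a + a := by exact_mod_cast ha
    rcases hc with rfl | rfl
    · refine ⟨Or.inl fun i => ⟨v i, by simp⟩, a, ?_⟩
      simp only [add_zero, hsum]
      ring
    · refine ⟨Or.inr fun i => ⟨v i, rfl⟩, a + 2, ?_⟩
      rw [Finset.sum_add_distrib, hsum]
      simp only [Finset.sum_const, Finset.card_univ, Fintype.card_fin, nsmul_eq_mul]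
      push_cast
      ring⟩

theorem E8Lattice.translate_bijective :
    Function.Bijective (Sum.elim (E8Lattice.translate 0 (Or.inl rfl))
      (E8Lattice.translate (1 / 2) (Or.inr rfl))) := by
  constructor
  · refine Function.Injective.sumElim ?_ ?_ ?_
    · intro v w h
      ext i
      simpa [translate] using congrFun (congrArg Subtype.val h) i
    · intro v w h
      ext i
      simpa [translate] using congrFun (congrArg Subtype.val h) i
    · intro v w h
      have h0 : (v.1 0 : ℝ) + 0 = w.1 0 + 1 / 2 := congrFun (congrArg Subtype.val h) 0
      have h1 : 2 * v.1 0 = 2 * w.1 0 + 1 := by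
        have : (2 * v.1 0 : ℝ) = 2 * w.1 0 + 1 := by linarith
        exact_mod_cast this
      omega
  · rintro ⟨x, hmem⟩
    obtain ⟨hx, a, ha⟩ := id hmem
    rcases hx with hx | hx <;> choose v hv using hx
    · refine ⟨Sum.inl ⟨v, a, ?_⟩, Subtype.ext (funext fun i => by simp [translate, hv])⟩
      have : (∑ i, (v i : ℝ)) = a + a := by
        simp only [hv] at ha
        linarith
      exact_mod_cast this
    · refine ⟨Sum.inr ⟨v, a - 2, ?_⟩, Subtype.ext (funext fun i => by simp [translate, hv])⟩
      have : (∑ i, (v i : ℝ)) = (a - 2) + (a - 2) := by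
        simp only [hv, Finset.sum_add_distrib, Finset.sum_const, Finset.card_univ,
          Fintype.card_fin, nsmul_eq_mul] at ha
        push_cast at ha
        linarith
      exact_mod_cast this

theorem exp_translate_eq_prod_thetaTerm (τ : ℂ) (m : Fin 8 → ℂ) (c : ℝ) (hc : c = 0 ∨ c = 1 / 2)
    (v : {v : Fin 8 → ℤ | Even (∑ i, v i)}) :
    Complex.exp (Real.pi * Complex.I * τ *
      (dotR (E8Lattice.translate c hc v) (E8Lattice.translate c hc v) : ℂ) +
      2 * Real.pi * Complex.I * dotC m (E8Lattice.translate c hc v)) =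
    ∏ i, thetaTerm τ c (m i) (v.1 i) := by
  simp only [thetaTerm, ← Complex.exp_sum, dotR, dotC, E8Lattice.translate]
  push_cast
  rw [Finset.mul_sum, Finset.mul_sum, ← Finset.sum_add_distrib]
  congr 1
  refine Finset.sum_congr rfl fun i _ => ?_
  ring

/-- The E₈ theta function is half the sum of products of the four Jacobi
theta functions over the eight arguments. -/
theorem statement12 (τ : ℂ) (hτ : 0 < τ.im) (m : Fin 8 → ℂ) :
    ThetaE8 τ m = (1 / 2) *
      ((∏ ℓ, theta1 τ (m ℓ)) + (∏ ℓ, theta2 τ (m ℓ)) +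
       (∏ ℓ, theta3 τ (m ℓ)) + (∏ ℓ, theta4 τ (m ℓ))) := by
  have hinteger := hasSum_prod_thetaTerm_even hτ 0 m
  have hhalf := hasSum_prod_thetaTerm_even hτ (1 / 2) m
  simp only [← exp_translate_eq_prod_thetaTerm τ m 0 (Or.inl rfl)] at hinteger
  simp only [← exp_translate_eq_prod_thetaTerm τ m (1 / 2) (Or.inr rfl)] at hhalf
  have h1 : ∏ ℓ, theta1 τ (m ℓ) =
      ∏ ℓ, ∑' n : ℤ, (-1 : ℂ) ^ n * thetaTerm τ (1 / 2) (m ℓ) n := by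
    simp only [theta1, Finset.prod_mul_distrib, Finset.prod_const, Finset.card_univ,
      Fintype.card_fin, thetaTerm]
    rw [show (-Complex.I) ^ 8 = (Complex.I ^ 2) ^ 4 by ring, Complex.I_sq]
    norm_num
  have h2 : ∏ ℓ, theta2 τ (m ℓ) = ∏ ℓ, ∑' n, thetaTerm τ (1 / 2) (m ℓ) n := by
    simp [theta2, thetaTerm]
  have h3 : ∏ ℓ, theta3 τ (m ℓ) = ∏ ℓ, ∑' n, thetaTerm τ 0 (m ℓ) n := by
    simp [theta3, thetaTerm]
  have h4 : ∏ ℓ, theta4 τ (m ℓ) = ∏ ℓ, ∑' n : ℤ, (-1 : ℂ) ^ n * thetaTerm τ 0 (m ℓ) n := by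
    simp [theta4, thetaTerm]
  have hsum := (Equiv.ofBijective _ E8Lattice.translate_bijective).hasSum_iff.mp
    (HasSum.sum (f := (fun w : E8Lattice => Complex.exp (Real.pi * Complex.I * τ *
      (dotR (w : Fin 8 → ℝ) (w : Fin 8 → ℝ) : ℂ) +
      2 * Real.pi * Complex.I * dotC m (w : Fin 8 → ℝ))) ∘
      Equiv.ofBijective _ E8Lattice.translate_bijective) hinteger hhalf)
  rw [ThetaE8, hsum.tsum_eq, h1, h2, h3, h4]
  ring
end
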